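/- For every finite simple graph with n vertices, if lambda_1 <= ... <= lambda_n are the eigenvalues of the Kirchhoff Laplacian L = D - A and d_1 <= ... <= d_n are the vertex degrees sorted in increasing order, then lambda_k <= 2 d_k for every k. -/

import Mathlib

open SimpleGraph


/-- Fuel-based definition of Ivashchenko contractibility of a finite simple graph.
The one-point graph is contractible; `G` is contractible if some vertex `v` has
contractible unit sphere `S(v)` and contractible `G \ v`. -/
def ContractibleFuel : ℕ → ∀ {V : Type}, SimpleGraph V → Prop
  | 0, _, _ => False
  | n+1, V, G =>
    (Nonempty V ∧ Subsingleton V) ∨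
    ∃ v : V, ContractibleFuel n (G.induce (G.neighborSet v)) ∧
             ContractibleFuel n (G.induce {w | w ≠ v})

/-- A finite graph is contractible (fuel `Nat.card V` suffices since each
reduction step strictly decreases the number of vertices). -/
def Contractible {V : Type} [Finite V] (G : SimpleGraph V) : Prop :=
  ContractibleFuel (Nat.card V) G

/-- Fuel-based definition of `d`-spheres: the empty graph is the `(-1)`-sphere;
a `d`-sphere is a graph all of whose unit spheres are `(d-1)`-spheres and which
becomes contractible after deleting some vertex. -/
def SphereFuel : ℕ → ℤ → ∀ {V : Type}, SimpleGraph V → Prop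
  | 0, d, V, _ => d = -1 ∧ IsEmpty V
  | n+1, d, V, G =>
    (d = -1 ∧ IsEmpty V) ∨
    ((∀ v : V, SphereFuel n (d-1) (G.induce (G.neighborSet v))) ∧
     ∃ v : V, ContractibleFuel n (G.induce {w | w ≠ v}))

/-- `G` is a `d`-sphere. -/
def IsSphere {V : Type} [Finite V] (d : ℤ) (G : SimpleGraph V) : Prop :=
  SphereFuel (Nat.card V + 1) d G

/-- `G` is a `d`-ball: a `d`-sphere with one vertex deleted. -/
def IsBall {V : Type} (d : ℤ) (G : SimpleGraph V) : Prop :=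
  ∃ (W : Type) (hW : Finite W) (H : SimpleGraph W) (v : W),
    @IsSphere W hW d H ∧ Nonempty (G ≃g H.induce {w | w ≠ v})

/-- `G` is a `q`-manifold: a nonempty graph all of whose unit spheres are `(q-1)`-spheres. -/
def IsGraphManifold {V : Type} [Finite V] (q : ℕ) (G : SimpleGraph V) : Prop :=
  Nonempty V ∧ ∀ v : V, IsSphere ((q : ℤ) - 1) (G.induce (G.neighborSet v))

/-- `G` is a `q`-manifold with boundary: a nonempty graph all of whose unit spheres
are `(q-1)`-spheres or `(q-1)`-balls. -/
def IsManifoldWithBoundary {V : Type} [Finite V] (q : ℕ) (G : SimpleGraph V) : Prop :=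
  Nonempty V ∧ ∀ v : V,
    IsSphere ((q : ℤ) - 1) (G.induce (G.neighborSet v)) ∨
    IsBall ((q : ℤ) - 1) (G.induce (G.neighborSet v))

/-- The boundary of a `q`-manifold with boundary: the set of vertices whose
unit sphere is a `(q-1)`-ball. -/
def boundarySet {V : Type} (q : ℕ) (G : SimpleGraph V) : Set V :=
  {v | IsBall ((q : ℤ) - 1) (G.induce (G.neighborSet v))}

/-- `G` has maximal dimension `q`: its largest cliques have `q+1` vertices. -/
def MaxDim {V : Type} (G : SimpleGraph V) (q : ℕ) : Prop :=
  (∃ s : Finset V, G.IsNClique (q+1) s) ∧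
  ∀ s : Finset V, G.IsClique (s : Set V) → s.card ≤ q + 1

/-- A boundary face of a graph of maximal dimension `q`: a `(q-1)`-simplex
(clique with `q` vertices) contained in exactly one facet. -/
def IsBoundaryFace {V : Type} (G : SimpleGraph V) (q : ℕ) (s : Finset V) : Prop :=
  G.IsNClique q s ∧ {t : Finset V | G.IsNClique (q+1) t ∧ s ⊆ t}.ncard = 1

/-- An interior face: a `(q-1)`-simplex contained in exactly two facets. -/
def IsInteriorFace {V : Type} (G : SimpleGraph V) (q : ℕ) (s : Finset V) : Prop :=
  G.IsNClique q s ∧ {t : Finset V | G.IsNClique (q+1) t ∧ s ⊆ t}.ncard = 2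

/-- Vertices of the soft Barycentric refinement: all simplices of dimension
different from `q-1` (i.e. cliques whose cardinality is not `q`), together with
the boundary faces. -/
def softVerts {V : Type} (G : SimpleGraph V) (q : ℕ) : Set (Finset V) :=
  {s | s.Nonempty ∧ G.IsClique (s : Set V) ∧ (s.card ≠ q ∨ IsBoundaryFace G q s)}

/-- The soft Barycentric refinement `phi(G)` of a graph `G` of maximal dimension `q`:
two vertices are adjacent if one is strictly contained in the other, or if both are
facets whose intersection is an interior face. -/
noncomputable def softBary {V : Type} (G : SimpleGraph V) (q : ℕ) :
    SimpleGraph (softVerts G q) :=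
  letI := Classical.decEq V
  SimpleGraph.fromRel (fun a b =>
    (a : Finset V) ⊂ (b : Finset V) ∨
    (G.IsNClique (q+1) (a : Finset V) ∧ G.IsNClique (q+1) (b : Finset V) ∧
      IsInteriorFace G q ((a : Finset V) ∩ (b : Finset V))))

/-- Vertices of the Barycentric refinement: the nonempty cliques of `G`. -/
def cliqueVerts {V : Type} (G : SimpleGraph V) : Set (Finset V) :=
  {s | s.Nonempty ∧ G.IsClique (s : Set V)}

/-- The Barycentric refinement `psi(G)`: nonempty cliques, two being adjacent
if one is strictly contained in the other. -/
def bary {V : Type} (G : SimpleGraph V) : SimpleGraph (cliqueVerts G) :=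
  SimpleGraph.fromRel (fun a b => (a : Finset V) ⊂ (b : Finset V))

/-- The dual graph of a `q`-manifold: vertices are the facets (cliques with `q+1`
vertices), two facets being adjacent if their intersection has `q` vertices. -/
noncomputable def dualGraph {V : Type} (G : SimpleGraph V) (q : ℕ) :
    SimpleGraph {t : Finset V // G.IsNClique (q+1) t} :=
  letI := Classical.decEq V
  SimpleGraph.fromRel (fun a b => ((a : Finset V) ∩ (b : Finset V)).card = q)

/-- The number of cliques with `k` vertices (i.e. `(k-1)`-simplices) of `G`. -/
noncomputable def fcount {V : Type} (G : SimpleGraph V) (k : ℕ) : ℕ :=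
  Nat.card {s : Finset V // G.IsNClique k s}

/-- The vertex arboricity: the minimal number of parts in a partition of the
vertex set such that each part induces an acyclic subgraph. -/
noncomputable def vertexArboricity {V : Type} (G : SimpleGraph V) : ℕ :=
  sInf {n : ℕ | ∃ f : V → Fin n, ∀ i : Fin n, (G.induce (f ⁻¹' {i})).IsAcyclic}


/-- A real symmetric matrix is Hermitian. -/
theorem Matrix.IsSymm.isHermitianReal {n : ℕ} {A : Matrix (Fin n) (Fin n) ℝ}
    (hA : A.IsSymm) : A.IsHermitian := by
  rw [Matrix.IsHermitian, Matrix.conjTranspose_eq_transpose_of_trivial]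
  exact hA

/-- The eigenvalues of a real Hermitian (= symmetric) matrix, listed with
multiplicity in increasing order. -/
noncomputable def matEigList {n : ℕ} {A : Matrix (Fin n) (Fin n) ℝ}
    (hA : A.IsHermitian) : List ℝ :=
  Multiset.sort (Finset.univ.val.map hA.eigenvalues) (· ≤ ·)

/-- The Kirchhoff Laplacian `L = D - A` of a graph is Hermitian. -/
theorem lapHerm {V : Type} [Fintype V] [DecidableEq V] (G : SimpleGraph V)
    [DecidableRel G.Adj] : (G.lapMatrix ℝ).IsHermitian := by
  rw [Matrix.IsHermitian, Matrix.conjTranspose_eq_transpose_of_trivial]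
  exact G.isSymm_lapMatrix (R := ℝ)

/-- The eigenvalues of the Kirchhoff Laplacian of `G`, listed with multiplicity
in increasing order. -/
noncomputable def eigList {V : Type} [Fintype V] [DecidableEq V] (G : SimpleGraph V)
    [DecidableRel G.Adj] : List ℝ :=
  Multiset.sort (Finset.univ.val.map (lapHerm G).eigenvalues) (· ≤ ·)

/-- The vertex degrees of `G`, listed in increasing order. -/
noncomputable def degList {V : Type} [Fintype V] (G : SimpleGraph V)
    [DecidableRel G.Adj] : List ℕ :=
  Multiset.sort (Finset.univ.val.map (fun v => G.degree v)) (· ≤ ·)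

/-- The graph distance of two graphs on the same vertex set: the number of edges
in the symmetric difference of the edge sets. -/
noncomputable def graphDist {V : Type} [Fintype V] [DecidableEq V]
    (G H : SimpleGraph V) [DecidableRel G.Adj] [DecidableRel H.Adj] : ℕ :=
  (symmDiff G.edgeFinset H.edgeFinset).card

/-- A bundled finite simple graph. -/
structure FinGraph : Type 1 where
  V : Type
  fin : Finite V
  graph : SimpleGraph V

/-- The soft Barycentric refinement as an operation on bundled finite graphs. -/
noncomputable def softStep (q : ℕ) (H : FinGraph) : FinGraph :=
  letI := H.fin
  letI : Fintype H.V := Fintype.ofFinite _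
  { V := softVerts H.graph q
    fin := inferInstance
    graph := softBary H.graph q }

/-- Eigenvalues of the Kirchhoff Laplacian of a bundled finite graph, in
increasing order. -/
noncomputable def gEigList (H : FinGraph) : List ℝ :=
  letI := H.fin
  letI : Fintype H.V := Fintype.ofFinite _
  letI := Classical.decEq H.V
  letI : DecidableRel H.graph.Adj := Classical.decRel _
  eigList H.graph

/-- The spectral function `F_G(x) = lambda_{ceil(n x)}` on `(0,1]`, where
`lambda_1 <= ... <= lambda_n` are the Kirchhoff Laplacian eigenvalues. -/
noncomputable def specFun (H : FinGraph) : ℝ → ℝ :=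
  fun x => (gEigList H).getD (⌈(Nat.card H.V : ℝ) * x⌉₊ - 1) 0

/-- In a list sorted increasingly, the entry at index `k` is at most `c` iff more than `k`
entries are at most `c`. -/
theorem List.Pairwise.getElem_le_iff_lt_countP {α : Type*} [LinearOrder α] {l : List α}
    (hl : l.Pairwise (· ≤ ·)) {k : ℕ} (hk : k < l.length) (c : α) :
    l[k] ≤ c ↔ k < l.countP (· ≤ c) := by
  induction l generalizing k with
  | nil => simp at hk
  | cons a l ih =>
    rw [List.pairwise_cons] at hl
    by_cases hac : a ≤ c
    · cases k with
      | zero => simp [hac]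
      | succ k => simpa [hac] using ih hl.2 (by simpa using hk)
    · have hzero : l.countP (· ≤ c) = 0 := by
        rw [List.countP_eq_zero]
        intro b hb hbc
        exact hac ((hl.1 b hb).trans (by simpa using hbc))
      have hak : a ≤ (a :: l)[k] := by
        cases k with
        | zero => simp
        | succ k => exact hl.1 _ (List.getElem_mem _)
      simp only [List.countP_cons, hzero, hac]
      simpa using lt_of_lt_of_le (not_le.1 hac) hak

/-- The `k`-th smallest value of `f` is at most `c` iff `f` takes values at most `c` at more
than `k` points. -/
theorem getD_sort_map_le_iff {ι α : Type*} [Fintype ι] [LinearOrder α] (f : ι → α) {k : ℕ}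
    (hk : k < Fintype.card ι) (c d : α) :
    (Multiset.sort (Finset.univ.val.map f) (· ≤ ·)).getD k d ≤ c ↔
      k < (Finset.univ.filter fun i => f i ≤ c).card := by
  rw [List.getD_eq_getElem _ _ (by simpa using hk),
    (Multiset.pairwise_sort _ _).getElem_le_iff_lt_countP, ← Multiset.coe_countP,
    Multiset.sort_eq, Multiset.countP_map]
  rfl

open Matrix in
/-- The quadratic form of a real Hermitian matrix, shifted by a scalar, in eigenvector
coordinates. -/
theorem Matrix.IsHermitian.dotProduct_mulVec_sub_eq_sum {n : Type*} [Fintype n] [DecidableEq n]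
    {A : Matrix n n ℝ} (hA : A.IsHermitian) (c : ℝ) (x : n → ℝ) :
    x ⬝ᵥ A *ᵥ x - c * (x ⬝ᵥ x) =
      ∑ i, (hA.eigenvalues i - c) * (hA.eigenvectorBasis i ⬝ᵥ x) ^ 2 := by
  have parseval (y : n → ℝ) : x ⬝ᵥ y =
      ∑ i, (hA.eigenvectorBasis i ⬝ᵥ x) * (hA.eigenvectorBasis i ⬝ᵥ y) := by
    have h := hA.eigenvectorBasis.sum_inner_mul_inner (WithLp.toLp 2 x) (WithLp.toLp 2 y)
    simp only [EuclideanSpace.inner_eq_star_dotProduct, star_trivial] at h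
    rw [dotProduct_comm, ← h]
    exact Finset.sum_congr rfl fun i _ => by rw [dotProduct_comm y]
  have symm (i : n) : hA.eigenvectorBasis i ⬝ᵥ A *ᵥ x =
      hA.eigenvalues i * (hA.eigenvectorBasis i ⬝ᵥ x) := by
    have hAt : Aᵀ = A := by simpa [conjTranspose_eq_transpose_of_trivial] using hA.eq
    rw [dotProduct_mulVec, ← mulVec_transpose, hAt, hA.mulVec_eigenvectorBasis,
      smul_dotProduct, smul_eq_mul]
  rw [parseval, parseval, Finset.mul_sum, ← Finset.sum_sub_distrib]
  exact Finset.sum_congr rfl fun i _ => by rw [symm]; ring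

open Matrix in
/-- If the quadratic form of a Hermitian matrix is at most `c` times the squared norm on the
image of an injective linear map, then the dimension of the source is at most the number of
eigenvalues that are at most `c`. -/
theorem Matrix.IsHermitian.finrank_le_card_eigenvalues_le {n E : Type*} [Fintype n]
    [DecidableEq n] [AddCommGroup E] [Module ℝ E] {A : Matrix n n ℝ}
    (hA : A.IsHermitian) (c : ℝ) (f : E →ₗ[ℝ] n → ℝ) (hf : Function.Injective f)
    (h : ∀ e, f e ⬝ᵥ A *ᵥ f e ≤ c * (f e ⬝ᵥ f e)) :
    Module.finrank ℝ E ≤ (Finset.univ.filter fun i => hA.eigenvalues i ≤ c).card := by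
  let T := Finset.univ.filter fun i => hA.eigenvalues i ≤ c
  let g : E →ₗ[ℝ] T → ℝ :=
    (Matrix.of fun (i : T) => (hA.eigenvectorBasis i : n → ℝ)).mulVecLin ∘ₗ f
  have hg : Function.Injective g := by
    rw [← LinearMap.ker_eq_bot, LinearMap.ker_eq_bot']
    intro e he
    have low (i : n) (hi : hA.eigenvalues i ≤ c) : hA.eigenvectorBasis i ⬝ᵥ f e = 0 :=
      congrFun he ⟨i, by simpa [T] using hi⟩
    have nonneg (i : n) (_ : i ∈ Finset.univ) :
        0 ≤ (hA.eigenvalues i - c) * (hA.eigenvectorBasis i ⬝ᵥ f e) ^ 2 := by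
      rcases le_or_gt (hA.eigenvalues i) c with hi | hi
      · simp [low i hi]
      · exact mul_nonneg (sub_nonneg.2 hi.le) (sq_nonneg _)
    have sum_zero := le_antisymm
      ((hA.dotProduct_mulVec_sub_eq_sum c (f e)).symm.trans_le (sub_nonpos.2 (h e)))
      (Finset.sum_nonneg nonneg)
    rw [Finset.sum_eq_zero_iff_of_nonneg nonneg] at sum_zero
    have coord (i : n) : hA.eigenvectorBasis i ⬝ᵥ f e = 0 := by
      rcases le_or_gt (hA.eigenvalues i) c with hi | hi
      · exact low i hi
      · simpa [(sub_pos.2 hi).ne'] using sum_zero i (Finset.mem_univ i)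
    have fe : f e ⬝ᵥ f e = 0 := by
      -- shifts by `0` and `1` differ by the squared norm
      have h0 := hA.dotProduct_mulVec_sub_eq_sum 0 (f e)
      have h1 := hA.dotProduct_mulVec_sub_eq_sum 1 (f e)
      simp only [coord] at h0 h1
      norm_num at h0 h1
      linarith
    exact hf ((dotProduct_self_eq_zero.1 fe).trans (map_zero f).symm)
  simpa only [Module.finrank_fintype_fun_eq_card, Fintype.card_coe] using
    LinearMap.finrank_le_finrank_of_injective hg

open Matrix in
/-- The Kirchhoff Laplacian is dominated by twice the degree matrix. -/
theorem SimpleGraph.dotProduct_lapMatrix_mulVec_le {V : Type*} [Fintype V] [DecidableEq V]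
    (G : SimpleGraph V) [DecidableRel G.Adj] (x : V → ℝ) :
    x ⬝ᵥ G.lapMatrix ℝ *ᵥ x ≤ 2 * ∑ v, G.degree v * x v ^ 2 := by
  have hdeg : ∑ v, (G.degree v : ℝ) * x v ^ 2 =
      ∑ v, ∑ w, if G.Adj v w then x v ^ 2 else 0 := by
    simp_rw [G.degree_eq_sum_if_adj, Finset.sum_mul, ite_mul, one_mul, zero_mul]
  have hdeg_swap : ∑ v, (G.degree v : ℝ) * x v ^ 2 =
      ∑ v, ∑ w, if G.Adj v w then x w ^ 2 else 0 := by
    rw [hdeg, Finset.sum_comm]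
    simp_rw [G.adj_comm]
  have hle : ∑ v, ∑ w, (if G.Adj v w then (x v - x w) ^ 2 else 0) ≤
      ∑ v, ∑ w, (2 * (if G.Adj v w then x v ^ 2 else 0) +
        2 * (if G.Adj v w then x w ^ 2 else 0)) := by
    gcongr with v _ w _
    split_ifs
    · nlinarith [sq_nonneg (x v + x w)]
    · simp
  simp_rw [Finset.sum_add_distrib, ← Finset.mul_sum] at hle
  rw [← hdeg, ← hdeg_swap] at hle
  rw [← toLinearMap₂'_apply', lapMatrix_toLinearMap₂' ℝ G]
  linarith

open Matrix in
/-- At least as many Laplacian eigenvalues are at most `2 * d` as there are vertices of degree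
at most `d`. -/
theorem SimpleGraph.card_degree_le_le_card_eigenvalues_le {V : Type} [Fintype V]
    [DecidableEq V] (G : SimpleGraph V) [DecidableRel G.Adj] (d : ℕ) :
    (Finset.univ.filter fun v => G.degree v ≤ d).card ≤
      (Finset.univ.filter fun i => (lapHerm G).eigenvalues i ≤ 2 * (d : ℝ)).card := by
  let S := Finset.univ.filter fun v => G.degree v ≤ d
  let f : (S → ℝ) →ₗ[ℝ] V → ℝ := Function.ExtendByZero.linearMap ℝ Subtype.val
  have hf : Function.Injective f := by
    intro a b hab
    ext s
    simpa [f, Subtype.val_injective.extend_apply] using congrFun hab s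
  have hsupp (a : S → ℝ) (v : V) (hv : ¬ G.degree v ≤ d) : f a v = 0 := by
    refine Function.extend_apply' _ _ _ ?_
    rintro ⟨s, rfl⟩
    exact hv (Finset.mem_filter.1 s.2).2
  have hbound (a : S → ℝ) :
      f a ⬝ᵥ G.lapMatrix ℝ *ᵥ f a ≤ 2 * (d : ℝ) * (f a ⬝ᵥ f a) := by
    refine (G.dotProduct_lapMatrix_mulVec_le (f a)).trans ?_
    rw [mul_assoc, dotProduct, Finset.mul_sum (a := (d : ℝ))]
    refine mul_le_mul_of_nonneg_left (Finset.sum_le_sum fun v _ => ?_) zero_le_two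
    by_cases hv : G.degree v ≤ d
    · rw [← sq]
      gcongr
    · simp [hsupp a v hv]
  simpa only [Module.finrank_fintype_fun_eq_card, Fintype.card_coe] using
    (lapHerm G).finrank_le_card_eigenvalues_le _ f hf hbound

theorem stmt18 {V : Type} [Fintype V] [DecidableEq V] (G : SimpleGraph V)
    [DecidableRel G.Adj] :
    ∀ k : ℕ, k < Fintype.card V →
      (eigList G).getD k 0 ≤ 2 * ((degList G).getD k 0 : ℝ) := by
  intro k hk
  exact (getD_sort_map_le_iff _ hk _ _).2 <|
    ((getD_sort_map_le_iff _ hk _ _).1 le_rfl).trans_le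
      (G.card_degree_le_le_card_eigenvalues_le _)
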